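/- Every planar point set of 9 points in general position with convex layer type (4,4,1) or (4,3,2) contains an empty convex pentagon; consequently, any 9-point set in general position obtained by adding one interior point to configuration 8 contains an empty convex pentagon. -/

import Mathlib

open scoped Classical
noncomputable section

/-- Points in the plane. -/
abbrev Pt := ℝ × ℝ

/-- Signed area determinant of the triple (p, q, r). -/
def det (p q r : Pt) : ℝ := (q.1 - p.1) * (r.2 - p.2) - (q.2 - p.2) * (r.1 - p.1)

/-- A finite point set is in general position if no three distinct points are collinear. -/
def GenPos (S : Finset Pt) : Prop :=
  ∀ p ∈ S, ∀ q ∈ S, ∀ r ∈ S, p ≠ q → p ≠ r → q ≠ r → ¬ Collinear ℝ ({p, q, r} : Set Pt)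

/-- A finite point set is in convex position if no point lies in the
convex hull of the others. -/
def ConvexPos (S : Finset Pt) : Prop :=
  ∀ p ∈ S, p ∉ convexHull ℝ ((S.erase p : Finset Pt) : Set Pt)

/-- The vertices of the convex hull of a finite point set. -/
def hullVerts (S : Finset Pt) : Finset Pt :=
  S.filter (fun p => p ∉ convexHull ℝ ((S.erase p : Finset Pt) : Set Pt))

/-- `S` is an empty convex pentagon of the point set `P`. -/
def EmptyConvexPentagon (P S : Finset Pt) : Prop :=
  S ⊆ P ∧ S.card = 5 ∧ ConvexPos S ∧
    ∀ p ∈ P, p ∉ S → p ∉ interior (convexHull ℝ (S : Set Pt))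

/-- Type-1 beam `a : bc`: the convex cone with apex `a` spanned by the rays from `a`
through `b` and through `c`, minus the triangle `abc`. -/
def beam1 (a b c : Pt) : Set Pt :=
  {x | (∃ s t : ℝ, 0 ≤ s ∧ 0 ≤ t ∧ x = a + s • (b - a) + t • (c - a)) ∧
       x ∉ convexHull ℝ ({a, b, c} : Set Pt)}

/-- Type-2 beam `pq : rs`: the convex region bounded by the segment `pq`, the ray
from `p` through `s` and the ray from `q` through `r`, minus the quadrilateral `pqrs`. -/
def beam2 (p q r s : Pt) : Set Pt :=
  {x | (∃ y ∈ segment ℝ p q, ∃ u v : ℝ, 0 ≤ u ∧ 0 ≤ v ∧ x = y + u • (s - p) + v • (r - q)) ∧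
       x ∉ convexHull ℝ ({p, q, r, s} : Set Pt)}

/-- The O-region of triangle `abc` opposite the vertex `a`: points separated from `a`
by line `bc`, on the same side of line `ac` as `b`, and on the same side of line `ab` as `c`. -/
def ORegionOpp (a b c : Pt) : Set Pt :=
  {x | det b c x * det b c a < 0 ∧ det a c x * det a c b > 0 ∧ det a b x * det a b c > 0}

/-- The I-region of triangle (or quadrilateral) at vertex `a` relative to the remaining
vertex set `R`: points `x` such that `a` lies strictly inside the convex hull of `{x} ∪ R`. -/
def IRegion (a : Pt) (R : Set Pt) : Set Pt :=
  {x | a ∈ interior (convexHull ℝ (insert x R))}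

/-- A convex quadrilateral with vertices `a b c d` in this cyclic order. -/
def CyclicQuad (a b c d : Pt) : Prop :=
  ConvexPos ({a, b, c, d} : Finset Pt) ∧ ({a, b, c, d} : Finset Pt).card = 4 ∧
    det a c b * det a c d < 0 ∧ det b d a * det b d c < 0

/-! ### Orientations of labelled points -/

/-- `Ccw f i j k`: the points `f i`, `f j`, `f k` form a counterclockwise triangle. -/
def Ccw (f : ℕ → Pt) (i j k : ℕ) : Prop := 0 < det (f i) (f j) (f k)

/-- The first nine values of `f` are in general position, and `f 1, …, f 8` are listed in
counterclockwise order as seen from `f 0`. -/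
structure RadiallySorted (f : ℕ → Pt) : Prop where
  sorted : ∀ j k, 0 < j → j < k → k < 9 → Ccw f 0 j k
  det_ne : ∀ i j k, i < 9 → j < 9 → k < 9 → i ≠ j → i ≠ k → j ≠ k →
    det (f i) (f j) (f k) ≠ 0

theorem ccw_rotate {f : ℕ → Pt} {i j k : ℕ} : Ccw f i j k ↔ Ccw f j k i := by
  unfold Ccw det
  constructor <;> intro h <;> nlinarith

theorem pos_or_nonpos_middle {u v w x y z : ℝ} (hu : 0 < u) (hv : 0 < v) (hw : 0 < w)
    (h : u * y = v * x + w * z) : (0 < x → 0 < z → 0 < y) ∧ (¬ 0 < x → ¬ 0 < z → ¬ 0 < y) := by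
  refine ⟨fun hx hz => ?_, fun hx hz hy => ?_⟩
  · have : 0 < u * y := by rw [h]; positivity
    exact pos_of_mul_pos_right this hu.le
  · have h1 : v * x ≤ 0 := mul_nonpos_of_nonneg_of_nonpos hv.le (not_lt.1 hx)
    have h2 : w * z ≤ 0 := mul_nonpos_of_nonneg_of_nonpos hw.le (not_lt.1 hz)
    have h3 : 0 < u * y := mul_pos hu hy
    linarith

namespace RadiallySorted

variable {f : ℕ → Pt}

theorem swap (hf : RadiallySorted f) {i j k : ℕ} (hi : i < 9) (hj : j < 9) (hk : k < 9)
    (hij : i ≠ j) (hik : i ≠ k) (hjk : j ≠ k) : Ccw f j i k ↔ ¬ Ccw f i j k := by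
  have h0 := hf.det_ne i j k hi hj hk hij hik hjk
  have h1 : det (f j) (f i) (f k) = - det (f i) (f j) (f k) := by unfold det; ring
  unfold Ccw
  rw [h1, not_lt, neg_pos]
  exact ⟨le_of_lt, fun h => lt_of_le_of_ne h h0⟩

/-- Among the orientations of the four triples of an increasing quadruple, listed
lexicographically, the sign changes at most once. -/
theorem signotope (hf : RadiallySorted f) {a b c d : ℕ} (hab : a < b) (hbc : b < c) (hcd : c < d)
    (hd : d < 9) :
    ((Ccw f a b c → Ccw f a c d → Ccw f a b d) ∧
      (¬ Ccw f a b c → ¬ Ccw f a c d → ¬ Ccw f a b d)) ∧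
    ((Ccw f a b c → Ccw f b c d → Ccw f a b d) ∧
      (¬ Ccw f a b c → ¬ Ccw f b c d → ¬ Ccw f a b d)) ∧
    ((Ccw f a b c → Ccw f b c d → Ccw f a c d) ∧
      (¬ Ccw f a b c → ¬ Ccw f b c d → ¬ Ccw f a c d)) ∧
    ((Ccw f a b d → Ccw f b c d → Ccw f a c d) ∧
      (¬ Ccw f a b d → ¬ Ccw f b c d → ¬ Ccw f a c d)) := by
  rcases Nat.eq_zero_or_pos a with rfl | ha
  · have h1 := hf.sorted b c (by omega) (by omega) (by omega)
    have h2 := hf.sorted b d (by omega) (by omega) (by omega)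
    have h3 := hf.sorted c d (by omega) (by omega) (by omega)
    tauto
  · have h1 := hf.sorted a b (by omega) (by omega) (by omega)
    have h2 := hf.sorted a c (by omega) (by omega) (by omega)
    have h3 := hf.sorted a d (by omega) (by omega) (by omega)
    have h4 := hf.sorted b c (by omega) (by omega) (by omega)
    have h5 := hf.sorted b d (by omega) (by omega) (by omega)
    have h6 := hf.sorted c d (by omega) (by omega) (by omega)
    exact ⟨pos_or_nonpos_middle h2 h3 h1 (by unfold det; ring),
      pos_or_nonpos_middle h4 h5 h1 (by unfold det; ring),
      pos_or_nonpos_middle h4 h6 h2 (by unfold det; ring),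
      pos_or_nonpos_middle h5 h6 h3 (by unfold det; ring)⟩

end RadiallySorted

/-- For `a < b < c` and `a < y < c` with `y ≠ b`, in a radially sorted family:
`f y` lies in the triangle with vertices `f a`, `f b`, `f c`. -/
def InTriangle (f : ℕ → Pt) (y a b c : ℕ) : Prop :=
  if y < b then ¬ (Ccw f a y b ↔ Ccw f a y c) else ¬ (Ccw f b y c ↔ Ccw f a y c)

/-- For `a < b < c`, in a radially sorted family: the triangle with vertices `f a`, `f b`, `f c`
contains no other point of the family. -/
def EmptyTriangle (f : ℕ → Pt) (a b c : ℕ) : Prop :=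
  ∀ y, a < y → y < c → y ≠ b → ¬ InTriangle f y a b c

namespace RadiallySorted

variable {f : ℕ → Pt}

theorem not_emptyTriangle (hf : RadiallySorted f) {y a b c : ℕ} (hab : a < b) (hbc : b < c)
    (hc : c < 9) (hy : y < 9) (hya : y ≠ a) (hyb : y ≠ b) (hyc : y ≠ c)
    (h : (Ccw f a b y ∧ Ccw f b c y ∧ Ccw f c a y) ∨ (Ccw f b a y ∧ Ccw f c b y ∧ Ccw f a c y)) :
    ¬ EmptyTriangle f a b c := by
  have e1 := hf.swap (i := a) (j := b) (k := y) (by omega) (by omega) hy (by omega)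
    (by omega) (by omega)
  have e2 := hf.swap (i := b) (j := c) (k := y) (by omega) (by omega) hy (by omega)
    (by omega) (by omega)
  have e3 := hf.swap (i := a) (j := c) (k := y) (by omega) (by omega) hy (by omega)
    (by omega) (by omega)
  have g1 := hf.swap (i := a) (j := y) (k := b) (by omega) (by omega) (by omega) (by omega)
    (by omega) (by omega)
  have g2 := hf.swap (i := b) (j := y) (k := c) (by omega) (by omega) (by omega) (by omega)
    (by omega) (by omega)
  have g3 := hf.swap (i := a) (j := y) (k := c) (by omega) (by omega) (by omega) (by omega)
    (by omega) (by omega)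
  have r1 : Ccw f y a b ↔ Ccw f a b y := ccw_rotate
  have r2 : Ccw f y b c ↔ Ccw f b c y := ccw_rotate
  have r3 : Ccw f y a c ↔ Ccw f a c y := ccw_rotate
  rcases lt_or_gt_of_ne hya with h1 | h1
  · have := hf.signotope h1 hab hbc hc
    grind
  rcases lt_or_gt_of_ne hyc with h2 | h2
  · intro he
    have he' := he y h1 h2 hyb
    unfold InTriangle at he'
    rcases lt_or_gt_of_ne hyb with h3 | h3
    · rw [if_pos h3] at he'
      grind
    · rw [if_neg (by omega)] at he'
      grind
  · have := hf.signotope hab hbc h2 hy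
    grind

end RadiallySorted

/-! ### Propositional encoding -/

/-- The number with decimal digits `a b c`. -/
def triple (a b c : ℕ) : ℕ := 100 * a + 10 * b + c

/-- The `i`-th decimal digit of `n`. -/
def digit (n i : ℕ) : ℕ := n / 10 ^ i % 10

/-- The meaning of the propositional variable `n`: with `a`, `b`, `c` the last three digits,
`abc` is an orientation, `1abc` says that a triangle is empty, and the variables
`(y + 2)abc` say that the point labelled `y` lies in a triangle. -/
def Holds (f : ℕ → Pt) (n : ℕ) : Prop :=
  match n / 1000 with
  | 0 => Ccw f (digit n 2) (digit n 1) (digit n 0)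
  | 1 => EmptyTriangle f (digit n 2) (digit n 1) (digit n 0)
  | y + 2 => InTriangle f y (digit n 2) (digit n 1) (digit n 0)

/-- The truth value of the literal `l`, which is variable `l / 2`, negated if `l` is odd. -/
def HoldsLit (f : ℕ → Pt) (l : ℕ) : Prop :=
  if l % 2 = 0 then Holds f (l / 2) else ¬ Holds f (l / 2)

/-- The positive literal of a variable. -/
def pos (v : ℕ) : ℕ := 2 * v

/-- The negative literal of a variable. -/
def neg (v : ℕ) : ℕ := 2 * v + 1

/-- Sort three labels, recording the parity of the permutation. -/
def sortTriple (a b c : ℕ) : ℕ × Bool :=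
  if a < b then
    if b < c then (triple a b c, true) else
    if a < c then (triple a c b, false) else (triple c a b, true)
  else
    if a < c then (triple b a c, false) else
    if b < c then (triple b c a, true) else (triple c b a, false)

/-- The literal saying that `a`, `b`, `c` are not counterclockwise. -/
def notCcw (a b c : ℕ) : ℕ :=
  match sortTriple a b c with
  | (n, true) => neg n
  | (n, false) => pos n

/-- The literal saying that the triangle `a b c` is not empty. -/
def notEmpty (a b c : ℕ) : ℕ := neg (1000 + (sortTriple a b c).1)

/-- The variable saying that `y` lies in the triangle `a b c`. -/
def inTri (y a b c : ℕ) : ℕ := 1000 * (y + 2) + triple a b c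

/-- The true clauses used in the refutations, indexed by six-digit numbers:
`1kabcd` forbids two sign changes in the quadruple `abcd`, `2kyabc` is half of the definition
of membership of `y` in `abc`, `300abc` says that a triangle without points is empty, and
`4abcde` says that the convex pentagon `abcde` is not composed of three empty triangles. -/
def clause (n : ℕ) : List ℕ :=
  let k := digit n 4
  let a := digit n 3
  let b := digit n 2
  let c := digit n 1
  let d := digit n 0
  match n / 100000 with
  | 1 =>
    if a < b ∧ b < c ∧ c < d ∧ d < 9 then
      match k with
      | 0 => [neg (triple a b c), pos (triple a b d), neg (triple a c d)]
      | 1 => [pos (triple a b c), neg (triple a b d), pos (triple a c d)]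
      | 2 => [neg (triple a b c), pos (triple a b d), neg (triple b c d)]
      | 3 => [pos (triple a b c), neg (triple a b d), pos (triple b c d)]
      | 4 => [neg (triple a b c), pos (triple a c d), neg (triple b c d)]
      | 5 => [pos (triple a b c), neg (triple a c d), pos (triple b c d)]
      | 6 => [neg (triple a b d), pos (triple a c d), neg (triple b c d)]
      | _ => [pos (triple a b d), neg (triple a c d), pos (triple b c d)]
    else [0, 1]
  | 2 =>
    let t := if a < c then triple b a c else triple c a d
    match k with
    | 0 => [neg (inTri a b c d), pos t, pos (triple b a d)]
    | _ => [neg (inTri a b c d), neg t, neg (triple b a d)]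
  | 3 =>
    pos (1000 + triple b c d) ::
      ((List.range 9).filter fun y => b < y ∧ y < d ∧ y ≠ c).map fun y => pos (inTri y b c d)
  | 4 =>
    if [k, a, b, c, d].Nodup ∧ k < 9 ∧ a < 9 ∧ b < 9 ∧ c < 9 ∧ d < 9 then
      [notEmpty k a b, notEmpty k b c, notEmpty k c d,
        notCcw k a b, notCcw k a c, notCcw k a d, notCcw k b c, notCcw k b d, notCcw k c d,
        notCcw a b c, notCcw a b d, notCcw a c d, notCcw b c d]
    else [0, 1]
  | _ => [0, 1]

/-- Case-splitting refutations by unit propagation. -/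
inductive Refutation
  /-- Propagate the listed clauses until one of them is violated. -/
  | close (rules : List ℕ)
  /-- Propagate the listed clauses, then split on the value of a variable. -/
  | split (v : ℕ) (rules : List ℕ) (t e : Refutation)

/-- Record, in the set of false literals coded by the binary digits of `F`, that `l` is true. -/
def assign (F l : ℕ) : ℕ := F ||| 1 <<< (if l % 2 = 0 then l + 1 else l - 1)

/-- Unit propagation; `none` signals a contradiction. -/
def propagate (F : ℕ) : List ℕ → Option ℕ
  | [] => some F
  | n :: rules =>
    match (clause n).filter fun l => !F.testBit l with
    | [] => none
    | [l] => propagate (assign F l) rules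
    | _ => propagate F rules

/-- Check a refutation, starting from the set `F` of false literals. -/
def Refutation.check (F : ℕ) : Refutation → Bool
  | close rules => (propagate F rules).isNone
  | split v rules t e =>
    match propagate F rules with
    | none => true
    | some F' => t.check (assign F' (pos v)) && e.check (assign F' (neg v))

/-- The literals that hold if the convex hull has vertices `0`, `1`, `h`, `8`. -/
def hullLits (h : ℕ) : List ℕ :=
  ((List.range 9).flatMap fun k => (List.range k).flatMap fun j =>
    if 0 < j then [pos (triple 0 j k)] else []) ++
  pos (triple 1 h 8) :: ((List.range 8).flatMap fun i =>
    (if 1 < i ∧ i < h then [neg (triple 1 i h)] else []) ++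
      if h < i then [neg (triple h i 8)] else [])

/-- Refutations for each position of the third hull vertex in the angular order. -/
def hullRefutation : ℕ → Refutation
  | 2 =>
    .split 134 [300123, 300234, 300345, 300456, 300567, 300678, 211035, 211034, 211046,
      211045, 211057, 211056, 211068, 211067, 211078, 212034, 212035, 212045, 212046, 212057,
      212056, 212067, 212068, 212078, 213046, 213045, 213056, 213057, 213067, 213068, 213078,
      214056, 214057, 214068, 214067, 214078, 215068, 215067, 215078, 216078, 131238, 131248,
      131258, 131268, 131278, 300034, 300045, 300056, 300067, 300078, 212134, 212013, 212014,
      300134, 300013]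
      (.split 346 [434012, 213014, 300014]
        (.close [141346, 121346, 446013, 300046, 215046, 131456, 133456, 445013, 101345])
        (.split 256 [132346, 152346, 203268, 203246, 204268]
          (.close [172356, 102456, 172456, 102356, 103456, 443256, 203245, 300245])
          (.split 245 [205268]
            (.close [161245, 152345, 445013, 101345])
            (.split 467 [112345, 204256, 203245, 203256, 300256, 300245]
              (.split 678 []
                (.close [217068, 124678, 144678, 300068, 404678, 300046, 215046,
                  154567, 154568, 467805, 145678])
                (.split 456 [207268, 300268]
                  (.close [104567, 404567, 152567, 155678, 135678, 132567,
                    465287])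
                  (.close [173456, 426543, 214035, 121345, 141345, 300035,
                    434501])))
              (.split 357 [152467, 133467, 173467, 132467, 112367, 206278, 206237,
                112567, 204237, 204267, 204278, 204257, 203257, 203267, 203278,
                205267, 205278, 300267, 300278, 427643, 300246, 205246, 144567,
                215046, 123456, 206357, 206257, 300046, 204235, 204357, 300357,
                300257, 300235]
                (.close [133567, 153457, 457643])
                (.split 578 [205237, 454327, 453276, 300237]
                  (.split 135 [144578, 124578, 155678, 217068, 300068]
                    (.split 146 [141356, 121356]
                      (.split 168 []
                        (.close [101468, 401468, 144568, 464578])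
                        (.close [141568, 141468, 464578]))
                      (.close [121456, 441356]))
                    (.close [131357, 427531, 151357]))
                  (.close [153578, 133578, 475328])))))))
      (.split 346 [161234, 203124, 203248, 300124]
        (.split 467 []
          (.split 146 [143467, 123467, 403467, 300046, 215046, 154567, 133456, 216057,
            216457, 214035, 300057, 300457, 300035]
            (.split 357 [131456]
              (.split 135 [403567]
                (.close [121357, 141357, 401357])
                (.close [151356, 446531, 131356]))
              (.close [123567, 453467, 143457]))
            (.split 468 [141246]
              (.split 357 [154568]
                (.split 578 [457034, 205467, 300467]
                  (.close [143578, 123578, 403578])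
                  (.close [134578, 154578, 165678, 475468]))
                (.close [123567, 453467, 143457]))
              (.close [114568, 104678, 206248, 131468, 124678, 151468, 205468,
                205248, 207248, 207468, 300248, 441286, 300468])))
          (.split 345 []
            (.split 235 [214035, 300035]
              (.close [161235, 435012])
              (.split 246 []
                (.split 356 [141246]
                  (.close [456034, 132456, 131456, 445312, 141356, 121356,
                    401356])
                  (.close [143456, 152356, 132356, 132456, 446532]))
                (.split 567 [152467, 132467, 162346, 112367, 206247, 206278,
                  204278, 203247, 203278]
                  (.split 678 [164567, 144567, 162567, 205247, 205467, 205278,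
                    300247, 300467, 300278]
                    (.close [145678, 125678, 405678])
                    (.close [154678, 476428, 134678]))
                  (.split 457 [206457, 300457]
                    (.close [114567, 403456, 163456])
                    (.split 356 [172457, 205247, 300247]
                      (.close [456034, 172456, 476542, 161245, 445312,
                        141356, 121356, 401356])
                      (.close [143456, 133567, 153567, 453476, 131347,
                        443127, 151347]))))))
            (.close [151345, 152345, 132345, 131345, 425431, 203245, 300245])))
        (.split 456 [151346, 131346, 132346, 152346, 443126, 203246, 300246]
          (.close [122456, 121456, 123456, 112345, 204235, 111345, 431254, 300235])
          (.close [172456, 205246])))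
  | 3 =>
    .split 245 [300012, 300123, 300234, 300345, 300456, 300567, 300678, 211024, 211025,
      211046, 211045, 211057, 211056, 211067, 211068, 211078, 212045, 212046, 212056, 212057,
      212067, 212068, 212078, 213046, 213045, 213057, 213056, 213068, 213067, 213078, 214056,
      214057, 214067, 214068, 214078, 215068, 215067, 215078, 216078, 151238, 132348, 131348,
      131358, 132358, 132368, 131368, 132378, 131378, 300045, 300056, 300067, 300078, 213124,
      213024, 213245, 213014, 213257, 213256, 213025, 300124, 300024, 300245]
      (.split 124 [445023, 214025, 300025]
        (.close [141245, 401245, 121245])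
        (.split 456 [202134, 300134]
          (.close [142456, 402456, 122456])
          (.split 678 [133456, 153456, 205346, 204356, 204368, 205368, 300346, 300356]
            (.split 567 [123678, 113567, 113467, 205367, 204367, 300367]
              (.close [125678, 145678, 405678])
              (.close [154567, 134567, 437654]))
            (.split 457 [207368, 300368]
              (.close [134567, 142457, 122457, 402457, 216057, 300057])
              (.split 467 [133457, 205467, 300467]
                (.split 256 [174567, 216057, 216457, 300057, 300457]
                  (.close [122567, 456702, 142567])
                  (.split 257 []
                    (.split 468 []
                      (.split 578 [154568]
                        (.close [142578, 122578, 402578])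
                        (.close [134578, 154578, 475468]))
                      (.split 125 []
                        (.close [141257, 401257, 121257])
                        (.split 146 [151256, 131256]
                          (.close [171246, 446521, 111456])
                          (.close [151468, 131468, 438641]))))
                    (.split 246 []
                      (.close [122467, 142467, 452467])
                      (.close [151246, 442136, 131246]))))
                (.close [134678, 153467, 154678, 464387]))))))
      (.split 124 [162345, 204235, 300235]
        (.split 257 [212014, 300014]
          (.split 456 [152457]
            (.split 246 [215046, 300046]
              (.close [121246, 161246, 401246])
              (.split 467 [142346, 204356, 300356]
                (.split 678 [404567, 132567, 456423, 153567, 113567, 205367,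
                  206378, 113467, 205378, 204367, 204378, 300378, 300367]
                  (.close [124678, 164678, 404678])
                  (.close [135678, 175678, 438765]))
                (.close [152467, 132467, 164567, 457642, 112567])))
            (.close [132456, 133456, 153456, 172456, 436542, 204356, 300356]))
          (.split 567 [162357, 112457, 205237, 205378, 113457, 204237, 204257, 204357,
            204378]
            (.close [122567, 123567, 205236, 112456, 113456, 204256, 204236, 300256,
              300236, 423654, 144567, 124567, 404567])
            (.split 578 [172567, 206257, 173567, 206237, 300257, 206378, 206357,
              300237, 423754, 300378, 300357, 134567, 215046, 300046]
              (.split 468 [144578, 155678, 124578, 217068, 300068]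
                (.split 146 [123468]
                  (.close [121468, 401468, 141468])
                  (.split 356 [141246, 121456]
                    (.close [442356, 142356])
                    (.split 125 [452376]
                      (.close [141256, 121256, 441256])
                      (.close [151257, 131257, 437521]))))
                (.close [144568, 464578, 124678]))
              (.close [152578, 132578, 438752]))))
        (.close [151245, 421354, 111245]))
  | 4 =>
    .split 235 [300012, 300123, 300234, 300345, 300456, 300567, 300678, 211025, 211023,
      211034, 211036, 211035, 211045, 211057, 211056, 211068, 211067, 211078, 212035, 212034,
      212036, 212045, 212056, 212057, 212068, 212067, 212078, 213045, 213057, 213056, 213068,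
      213067, 213078, 214057, 214056, 214068, 214067, 214078, 215068, 215067, 215078, 216078,
      151248, 151348, 133458, 131458, 132458, 132468, 131468, 133468, 133478, 132478, 131478,
      300023, 300034, 300045, 300056, 300067, 300078, 214035, 214356, 214357, 214235, 214256,
      214025, 214236, 214036, 214367, 300035, 300356, 300235]
      (.split 678 [213025, 402345, 300025]
        (.split 567 [144678, 217068, 300068]
          (.close [125678, 467805, 145678])
          (.split 356 [206457, 300457]
            (.close [142356, 122356, 402356])
            (.close [133567, 163456, 153567, 453476, 143457])))
        (.split 123 [207468]
          (.close [141235, 401235, 121235])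
          (.split 356 [202134, 300134]
            (.close [142356, 122356, 402356])
            (.split 367 [163456, 205346, 205468, 300346, 300468]
              (.split 236 [153567, 216057, 216357, 300057, 300357]
                (.split 257 [122367, 142367]
                  (.split 578 [457023, 402567, 205367, 300367]
                    (.close [142578, 402578, 122578])
                    (.split 125 [133578, 153578]
                      (.close [121257, 401257, 141257])
                      (.split 136 [131256, 151256]
                        (.close [131356, 436521])
                        (.split 368 []
                          (.close [153568, 475368])
                          (.close [131368, 448631, 151368])))))
                  (.close [162357, 102567, 452367]))
                (.close [151236, 432146, 131236]))
              (.close [153678, 133678, 143467, 463487])))))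
      (.split 457 [102345, 203124, 203245, 300124, 300245]
        (.close [163457, 403457, 300057, 216057, 134567, 133567, 403456])
        (.split 236 [205478]
          (.split 123 [132356, 215036, 300036]
            (.close [141236, 401236, 101236])
            (.close [151235, 111235, 445321]))
          (.split 567 [203256, 300256]
            (.split 356 [124567]
              (.close [123567, 403567, 143567])
              (.close [446532, 172356]))
            (.split 678 [174567, 206457, 206478, 300457, 300478]
              (.split 256 [217068, 300068]
                (.split 367 [172356, 215036, 215236, 300036, 300236]
                  (.close [123678, 403678, 143678])
                  (.split 257 [152367, 132367]
                    (.close [172357, 463257])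
                    (.split 125 [453247]
                      (.split 578 [121256, 131235, 141256, 212013, 300013]
                        (.split 568 [123578, 143578]
                          (.close [468035, 163568])
                          (.split 136 [463578]
                            (.close [141368, 121368, 401368])
                            (.close [431256, 101356])))
                        (.close [152578, 132578, 448752]))
                      (.close [131257, 151257, 447521]))))
                (.close [132567, 142456, 452476, 152567]))
              (.close [155678, 135678, 476548, 162456, 456324, 143456])))))
  | 5 =>
    .split 346 [300012, 300123, 300234, 300345, 300456, 300567, 300678, 211024, 211027,
      211023, 211034, 211036, 211047, 211046, 211068, 211067, 211078, 212034, 212036, 212046,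
      212047, 212067, 212068, 212078, 213047, 213046, 213067, 213068, 213078, 214067, 214068,
      214078, 215068, 215067, 215078, 216078, 151258, 151358, 151458, 131568, 133568, 134568,
      132568, 133578, 131578, 134578, 132578, 300023, 300034, 300067, 300078, 215346, 215036,
      215236, 215467, 215246, 215046, 215047, 215247, 215027, 300346, 300467, 300046]
      (.split 367 [445603, 214036, 300036]
        (.split 368 [103467, 403467, 144567, 206578, 300578]
          (.split 678 []
            (.close [403678, 163678])
            (.close [154678, 458764, 134678]))
          (.close [143468, 123678, 174678, 458764]))
        (.split 236 [143467, 143567, 206457, 206578, 300457, 300578]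
          (.split 123 [162346, 434602, 152345, 112345, 204235, 204125, 203125, 300235,
            300125]
            (.close [141236, 401236, 121236])
            (.close [131234, 151234, 454321]))
          (.split 247 [122356, 152367, 132367, 122346, 203246, 203125, 203245, 172345,
            300246, 300245, 204125, 300125]
            (.close [112467, 152347, 447632])
            (.split 478 [443257, 442576, 214236, 300236]
              (.split 124 [123478, 154678, 163478, 217068, 300068]
                (.split 368 [131234, 141246, 121246, 212013, 300013]
                  (.split 136 []
                    (.close [141368, 101368, 401368])
                    (.close [424631, 121346]))
                  (.close [163468, 463478]))
                (.close [131247, 457421, 151247]))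
              (.close [152478, 132478, 458742])))))
      (.split 123 [103456, 204356, 204135, 300356]
        (.split 234 [121235, 172345, 204235, 300235]
          (.close [121234, 141234, 401234])
          (.close [152346, 456432, 132346]))
        (.split 678 [202135, 300135]
          (.split 467 [125678]
            (.close [144678, 124678, 404678])
            (.close [153467, 464357, 133467]))
          (.split 367 [207568, 300568]
            (.split 236 [153467, 216047, 300047]
              (.split 247 [132346, 122367, 213246, 142367, 213247, 213024, 213027,
                300246, 216027, 216247, 300247, 300024]
                (.split 124 [447023, 446702, 214027, 204236, 300027, 300236]
                  (.close [141247, 424701, 121247])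
                  (.split 478 [151246, 111246]
                    (.close [122478, 402478, 142478])
                    (.split 368 [153478, 133478]
                      (.close [173468, 468743])
                      (.split 136 []
                        (.close [421364, 131346])
                        (.close [151368, 458631, 131368])))))
                (.close [162347, 122467, 442367]))
              (.close [122356, 131236, 151236, 432156]))
            (.close [133678, 143567, 153678, 463587]))))
  | 6 =>
    .split 578 [300012, 300123, 300234, 300345, 300456, 300567, 300678, 211023, 211027,
      211024, 211034, 211035, 211047, 211045, 211058, 211057, 211078, 212034, 212035, 212045,
      212047, 212058, 212057, 212078, 213047, 213045, 213057, 213058, 213078, 214057, 214058,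
      214078, 215078, 216078, 151268, 151368, 151468, 151568, 131678, 134678, 132678, 133678,
      135678, 300023, 300034, 300045, 300078, 216058, 216578, 216247, 216347, 216047, 216457,
      216027, 216357, 216057, 300578, 300457, 300057]
      (.split 357 [217058, 300058]
        (.close [143578, 123578, 403578, 300035, 214035, 153457, 153458, 144578, 404578])
        (.split 346 [123567, 205136]
          (.close [123467, 163456, 113456, 453467, 163457])
          (.split 345 [204136]
            (.split 123 [143457, 143456, 214035, 205467, 205346, 300035, 300467,
              300346]
              (.split 235 [141236, 212013, 203126, 172346, 172356, 300013, 204126,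
                204236, 205246, 205236, 205126, 300126, 300236]
                (.close [121235, 435012, 161235])
                (.split 247 [152357, 132357, 122345, 205247, 205267, 203247,
                  203267, 203246, 203245, 300247, 300246, 300245]
                  (.close [132457, 152347, 447532])
                  (.split 478 [467432, 442675, 204267, 214235, 300267, 300235]
                    (.split 124 [123478, 143478]
                      (.split 358 [121245, 141245]
                        (.split 138 []
                          (.close [161358, 401358, 101345, 424531])
                          (.close [121348, 121358, 431245]))
                        (.close [453478, 163458]))
                      (.close [151247, 421674, 131247]))
                    (.close [132478, 152478, 474268]))))
              (.split 234 [202136, 300136]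
                (.close [142345, 122345, 402345])
                (.close [131234, 132346, 151234, 152346, 432164])))
            (.split 457 [113457, 204356, 300356]
              (.close [144578, 104578, 404578])
              (.close [454367, 104567])))))
      (.split 457 [207568, 300568]
        (.split 245 [456704, 215047, 300047]
          (.close [142457, 102457, 402457, 300024, 213024, 152345, 152347, 403457,
            143457])
          (.split 235 [152456, 132456, 204256, 205126, 204126]
            (.split 357 [142356, 112345, 213245, 162345, 113456, 205136, 213024,
              300245, 204235, 204356, 204136, 300024, 300235, 300356]
              (.split 347 [122357, 162357, 215347, 213027, 213247, 215247, 215027,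
                300347, 300247]
                (.close [142347, 447023])
                (.split 124 [457423, 204357, 214027, 300357, 300027]
                  (.close [121247, 141247, 401247])
                  (.split 478 [131245, 151245, 121234, 202136, 300136]
                    (.close [122478, 142478, 478024])
                    (.split 358 [133478, 153478]
                      (.close [474358, 153458])
                      (.split 135 []
                        (.close [421354, 111345])
                        (.close [131358, 151358, 468531]))))))
              (.close [133578, 153578, 468753]))
            (.split 345 [112356, 203126, 203256, 300126, 300256]
              (.close [143457, 123457, 445703])
              (.split 123 [204235, 133456, 153456, 300235, 454326]
                (.close [141234, 401234, 121234])
                (.close [151235, 131235, 421653])))))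
        (.close [104567, 154578, 454687, 134578]))
  | 7 =>
    .split 568 [300012, 300123, 300234, 300345, 300456, 300567, 300678, 211023, 211026,
      211024, 211034, 211035, 211046, 211045, 211056, 211058, 211068, 212034, 212035, 212046,
      212045, 212058, 212056, 212068, 213045, 213046, 213056, 213058, 213068, 214058, 214056,
      214068, 215068, 151278, 151378, 151478, 151578, 151678, 300023, 300034, 300045, 300056,
      217358, 217058, 217568, 217068, 300568, 300068]
      (.split 456 [467805, 216058, 300058]
        (.close [124568, 144568, 404568])
        (.split 356 [154567, 114567, 205467, 206457, 300467, 300457]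
          (.close [123568, 153456, 143568, 403568, 214035, 300035])
          (.split 346 [133567, 153567, 205346, 205367, 205347, 205137, 206347, 206137,
            300346, 300347]
            (.split 123 [133456, 447653, 214356, 214035, 204137, 300356, 300035]
              (.split 235 [212013, 141237, 300013, 172367, 172347, 172357, 203127,
                206247, 206127, 204127, 205247, 205127, 300127]
                (.close [141235, 121235, 435012])
                (.split 246 [132356, 152356, 122345, 203247, 300247]
                  (.close [112456, 432465])
                  (.split 468 [476542]
                    (.split 124 [143468, 123468]
                      (.split 135 [121245, 141245]
                        (.split 358 []
                          (.close [121358, 141358, 401358])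
                          (.close [143458, 468534]))
                        (.close [431245, 101345]))
                      (.close [131246, 476421, 151246]))
                    (.close [132468, 152468, 478642]))))
              (.split 234 [202137, 300137]
                (.close [122345, 434502, 142345])
                (.close [152347, 151234, 131234, 432174, 132347])))
            (.split 234 [113467, 476543, 204367, 214035, 300367, 300035]
              (.close [122345, 434502, 142345])
              (.close [152347, 152346, 132347, 112346, 172467, 172457, 204237,
                432764, 206237, 205237, 300237])))))
      (.split 456 [125678, 206578, 300578]
        (.split 358 [215046, 300046]
          (.split 235 [133568, 215346, 300346]
            (.split 246 [122356, 142356, 402356, 300035, 214035, 153458, 132345,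
              213024, 300024]
              (.split 468 [402346, 204356, 300356]
                (.close [122468, 142468, 402468])
                (.close [153468, 133468, 464358]))
              (.close [122456, 142346, 442356]))
            (.split 467 []
              (.close [467804, 124678])
              (.split 345 []
                (.close [445603, 103456])
                (.split 347 [172345, 153458, 204235, 300235]
                  (.close [133467, 123478, 133457, 457864, 403468, 163468])
                  (.split 357 [173467]
                    (.close [173457, 457643, 457864, 143468, 403468, 103468])
                    (.split 256 [132357, 152357, 172367, 203257, 172347,
                      203127, 205127, 206257, 206127, 204127, 204257, 300127,
                      300257]
                      (.split 123 []
                        (.split 234 []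
                          (.close [213024, 121234, 161234, 300024,
                            423401])
                          (.split 346 [454327, 457864]
                            (.close [143468, 403468, 103468])
                            (.close [152346, 132346, 456432])))
                        (.close [131235, 421753, 151235]))
                      (.close [132568, 478652, 152568])))))))
          (.split 347 [173568, 123578, 205378, 206358, 123678, 206378, 205137, 206137,
            206357]
            (.close [113467, 113457, 403456, 163456])
            (.split 345 [204137]
              (.close [143456, 103456, 403456])
              (.split 235 [113458, 204357, 204358, 204378, 300357, 300358, 300378,
                478653]
                (.split 135 [132345, 122356, 142356, 213024, 213246, 213026,
                  215246, 215026, 300024, 300246]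
                  (.split 246 [131345]
                    (.split 124 [445602, 214026, 300026]
                      (.close [141246, 424601, 121246])
                      (.close [101234, 131245, 435421, 151245]))
                    (.close [122456, 142346, 442356]))
                  (.close [151358, 111358, 431785, 141235, 300137, 202137]))
                (.close [132357, 152357, 132358, 152358, 172367, 432785, 172347,
                  205237, 206237, 300237, 204237])))))
        (.close [154567, 114567, 205467, 134568, 154568, 465478, 300467]))
  | _ => .close []

theorem hullRefutation_check :
    ∀ h ∈ [2, 3, 4, 5, 6, 7], (hullRefutation h).check ((hullLits h).foldl assign 0) = true := by
  decide +kernel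

/-! ### Soundness of the encoding -/

theorem holdsLit_pos {f : ℕ → Pt} {v : ℕ} : HoldsLit f (pos v) ↔ Holds f v := by
  simp [HoldsLit, pos]

theorem holdsLit_neg {f : ℕ → Pt} {v : ℕ} : HoldsLit f (neg v) ↔ ¬ Holds f v := by
  have h1 : (2 * v + 1) % 2 = 1 := by omega
  have h2 : (2 * v + 1) / 2 = v := by omega
  simp [HoldsLit, neg, h1, h2]

theorem holds_triple {f : ℕ → Pt} {a b c : ℕ} (ha : a < 10) (hb : b < 10) (hc : c < 10) :
    Holds f (triple a b c) ↔ Ccw f a b c := by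
  have h0 : triple a b c / 1000 = 0 := by unfold triple; omega
  have h1 : digit (triple a b c) 2 = a := by unfold triple digit; omega
  have h2 : digit (triple a b c) 1 = b := by unfold triple digit; omega
  have h3 : digit (triple a b c) 0 = c := by unfold triple digit; omega
  simp only [Holds, h0, h1, h2, h3]

theorem holds_emptyTriangle {f : ℕ → Pt} {a b c : ℕ} (ha : a < 10) (hb : b < 10) (hc : c < 10) :
    Holds f (1000 + triple a b c) ↔ EmptyTriangle f a b c := by
  have h0 : (1000 + triple a b c) / 1000 = 1 := by unfold triple; omega
  have h1 : digit (1000 + triple a b c) 2 = a := by unfold triple digit; omega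
  have h2 : digit (1000 + triple a b c) 1 = b := by unfold triple digit; omega
  have h3 : digit (1000 + triple a b c) 0 = c := by unfold triple digit; omega
  simp only [Holds, h0, h1, h2, h3]

theorem holds_inTri {f : ℕ → Pt} {y a b c : ℕ} (ha : a < 10) (hb : b < 10) (hc : c < 10) :
    Holds f (inTri y a b c) ↔ InTriangle f y a b c := by
  have h0 : inTri y a b c / 1000 = y + 2 := by unfold inTri triple; omega
  have h1 : digit (inTri y a b c) 2 = a := by unfold inTri triple digit; omega
  have h2 : digit (inTri y a b c) 1 = b := by unfold inTri triple digit; omega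
  have h3 : digit (inTri y a b c) 0 = c := by unfold inTri triple digit; omega
  simp only [Holds, h0, h1, h2, h3]

theorem digit_lt {n i : ℕ} : digit n i < 10 := Nat.mod_lt _ (by norm_num)

/-- Every convex pentagon formed by the points of the family contains another one. -/
def NoEmptyPentagon (f : ℕ → Pt) : Prop :=
  ∀ a b c d e, a < 9 → b < 9 → c < 9 → d < 9 → e < 9 →
    Ccw f a b c → Ccw f a b d → Ccw f a b e → Ccw f a c d → Ccw f a c e → Ccw f a d e →
    Ccw f b c d → Ccw f b c e → Ccw f b d e → Ccw f c d e →
    ∃ y < 9, y ≠ a ∧ y ≠ b ∧ y ≠ c ∧ y ≠ d ∧ y ≠ e ∧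
      Ccw f a b y ∧ Ccw f b c y ∧ Ccw f c d y ∧ Ccw f d e y ∧ Ccw f e a y

namespace RadiallySorted

variable {f : ℕ → Pt}

theorem holdsLit_notCcw (hf : RadiallySorted f) {a b c : ℕ} (ha : a < 9) (hb : b < 9) (hc : c < 9)
    (hab : a ≠ b) (hac : a ≠ c) (hbc : b ≠ c) : HoldsLit f (notCcw a b c) ↔ ¬ Ccw f a b c := by
  have e1 := hf.swap ha hb hc hab hac hbc
  have e2 := hf.swap hc ha hb hac.symm hbc.symm hab
  have e3 := hf.swap hb hc ha hbc hab.symm hac.symm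
  have r1 : Ccw f a b c ↔ Ccw f b c a := ccw_rotate
  have r2 : Ccw f b c a ↔ Ccw f c a b := ccw_rotate
  have h : ∀ {i j k}, i < 9 → j < 9 → k < 9 → (Holds f (triple i j k) ↔ Ccw f i j k) :=
    fun hi hj hk => holds_triple (by omega) (by omega) (by omega)
  unfold notCcw sortTriple
  split_ifs <;> simp only [holdsLit_pos, holdsLit_neg] <;> rw [h ‹_› ‹_› ‹_›] <;> tauto

theorem holdsLit_notEmpty (hf : RadiallySorted f) {a b c y : ℕ} (ha : a < 9) (hb : b < 9)
    (hc : c < 9) (hab : a ≠ b) (hac : a ≠ c) (hbc : b ≠ c) (hy : y < 9) (hya : y ≠ a)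
    (hyb : y ≠ b) (hyc : y ≠ c) (h1 : Ccw f a b y) (h2 : Ccw f b c y) (h3 : Ccw f c a y) :
    HoldsLit f (notEmpty a b c) := by
  have h : ∀ {i j k}, i < 9 → j < 9 → k < 9 →
      (Holds f (1000 + triple i j k) ↔ EmptyTriangle f i j k) :=
    fun hi hj hk => holds_emptyTriangle (by omega) (by omega) (by omega)
  unfold notEmpty sortTriple
  rw [holdsLit_neg]
  split_ifs <;> dsimp only <;> rw [h ‹_› ‹_› ‹_›] <;>
    refine hf.not_emptyTriangle (by omega) (by omega) (by omega) hy ‹_› ‹_› ‹_› (by tauto)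

theorem exists_holdsLit_clause (hf : RadiallySorted f) (hp : NoEmptyPentagon f) (n : ℕ) :
    ∃ l ∈ clause n, HoldsLit f l := by
  have hk : digit n 4 < 10 := digit_lt
  have ha : digit n 3 < 10 := digit_lt
  have hb : digit n 2 < 10 := digit_lt
  have hc : digit n 1 < 10 := digit_lt
  have hd : digit n 0 < 10 := digit_lt
  have taut : ∃ l ∈ [0, 1], HoldsLit f l := by
    by_cases h : Holds f 0
    · exact ⟨0, by simp, (holdsLit_pos (v := 0)).2 h⟩
    · exact ⟨1, by simp, (holdsLit_neg (v := 0)).2 h⟩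
  unfold clause
  generalize digit n 4 = k at *
  generalize digit n 3 = a at *
  generalize digit n 2 = b at *
  generalize digit n 1 = c at *
  generalize digit n 0 = d at *
  dsimp only
  split
  · split_ifs with h
    · obtain ⟨hab, hbc, hcd, hd9⟩ := h
      have s := hf.signotope hab hbc hcd hd9
      split <;> simp only [List.mem_cons, List.not_mem_nil, or_false, exists_eq_or_imp,
          exists_eq_left, holdsLit_pos, holdsLit_neg, holds_triple, ha, hb, hc, hd] <;> grind
    · exact taut
  · split_ifs with h <;> split <;>
      simp only [List.mem_cons, List.not_mem_nil, or_false, exists_eq_or_imp, exists_eq_left,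
        holdsLit_pos, holdsLit_neg, holds_triple, holds_inTri, ha, hb, hc, hd] <;>
      simp only [InTriangle, h, if_true, if_false] <;> grind
  · by_cases h : EmptyTriangle f b c d
    · exact ⟨_, List.mem_cons_self, holdsLit_pos.2 ((holds_emptyTriangle hb hc hd).2 h)⟩
    · unfold EmptyTriangle at h
      push Not at h
      obtain ⟨y, hby, hyd, hyc, hy⟩ := h
      refine ⟨pos (inTri y b c d), List.mem_cons_of_mem _ (List.mem_map.2 ⟨y, ?_, rfl⟩),
        holdsLit_pos.2 ((holds_inTri hb hc hd).2 hy)⟩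
      simp only [List.mem_filter, List.mem_range, decide_eq_true_eq]
      exact ⟨by omega, hby, hyd, hyc⟩
  · split_ifs with h
    · obtain ⟨hn, hk, ha, hb, hc, hd⟩ := h
      simp only [List.nodup_cons, List.mem_cons, List.not_mem_nil, or_false, not_or,
        not_false_eq_true, List.nodup_nil, and_true] at hn
      obtain ⟨⟨hka, hkb, hkc, hkd⟩, ⟨hab, hac, had⟩, ⟨hbc, hbd⟩, hcd⟩ := hn
      by_contra! hcon
      simp only [List.mem_cons, List.not_mem_nil, or_false, forall_eq_or_imp, forall_eq] at hcon
      obtain ⟨t1, t2, t3, h1, h2, h3, h4, h5, h6, h7, h8, h9, h10⟩ := hcon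
      rw [hf.holdsLit_notCcw ‹_› ‹_› ‹_› ‹_› ‹_› ‹_›, not_not] at h1 h2 h3 h4 h5 h6 h7 h8 h9 h10
      obtain ⟨y, hy, yk, ya, yb, yc, yd, e1, e2, e3, e4, e5⟩ :=
        hp k a b c d hk ha hb hc hd h1 h2 h3 h4 h5 h6 h7 h8 h9 h10
      by_cases d1 : Ccw f b k y
      · exact t1 (hf.holdsLit_notEmpty hk ha hb hka hkb hab hy yk ya yb e1 e2 d1)
      by_cases d2 : Ccw f c k y
      · exact t2 (hf.holdsLit_notEmpty hk hb hc hkb hkc hbc hy yk yb yc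
          (by rwa [hf.swap hk hb hy hkb yk.symm yb.symm, not_not] at d1) e3 d2)
      · exact t3 (hf.holdsLit_notEmpty hk hc hd hkc hkd hcd hy yk yc yd
          (by rwa [hf.swap hk hc hy hkc yk.symm yc.symm, not_not] at d2) e4 e5)
    · exact taut
  · exact taut

end RadiallySorted

/-- `F` codes a set of false literals. -/
def AllFalse (f : ℕ → Pt) (F : ℕ) : Prop := ∀ l, F.testBit l = true → ¬ HoldsLit f l

theorem AllFalse.assign {f : ℕ → Pt} {F l : ℕ} (hF : AllFalse f F) (hl : HoldsLit f l) :
    AllFalse f (assign F l) := by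
  intro m hm
  rw [_root_.assign, Nat.testBit_lor, Bool.or_eq_true, Nat.one_shiftLeft, Nat.testBit_two_pow,
    decide_eq_true_eq] at hm
  rcases hm with hm | rfl
  · exact hF m hm
  · rcases Nat.even_or_odd' l with ⟨v, rfl | rfl⟩
    · rw [if_pos (by omega)]
      exact fun h => holdsLit_neg.1 h (holdsLit_pos.1 hl)
    · rw [if_neg (by omega)]
      exact fun h => holdsLit_neg.1 hl (holdsLit_pos.1 h)

theorem AllFalse.foldl_assign {f : ℕ → Pt} {L : List ℕ} (hL : ∀ l ∈ L, HoldsLit f l) {F : ℕ}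
    (hF : AllFalse f F) : AllFalse f (L.foldl _root_.assign F) := by
  induction L generalizing F with
  | nil => exact hF
  | cons l L ih =>
    exact ih (fun m hm => hL m (List.mem_cons_of_mem _ hm)) (hF.assign (hL l List.mem_cons_self))

theorem exists_propagate {f : ℕ → Pt} (hc : ∀ n, ∃ l ∈ clause n, HoldsLit f l) (rules : List ℕ)
    {F : ℕ} (hF : AllFalse f F) : ∃ F', propagate F rules = some F' ∧ AllFalse f F' := by
  induction rules generalizing F with
  | nil => exact ⟨F, rfl, hF⟩
  | cons n rules ih =>
    obtain ⟨l, hl, hh⟩ := hc n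
    have hmem : l ∈ (clause n).filter fun l => !F.testBit l := by
      rw [List.mem_filter]
      refine ⟨hl, ?_⟩
      by_contra h
      exact hF l (by simpa using h) hh
    unfold propagate
    split
    · rename_i h
      rw [h] at hmem
      simp at hmem
    · rename_i m h
      rw [h, List.mem_singleton] at hmem
      exact ih (hF.assign (hmem ▸ hh))
    · exact ih hF

theorem Refutation.check_eq_false {f : ℕ → Pt} (hc : ∀ n, ∃ l ∈ clause n, HoldsLit f l)
    (r : Refutation) {F : ℕ} (hF : AllFalse f F) : r.check F = false := by
  induction r generalizing F with
  | close rules =>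
    obtain ⟨F', h, -⟩ := exists_propagate hc rules hF
    simp [check, h]
  | split v rules t e iht ihe =>
    obtain ⟨F', h, hF'⟩ := exists_propagate hc rules hF
    rw [check, h]
    by_cases hv : Holds f v
    · simp [iht (hF'.assign (holdsLit_pos.2 hv))]
    · simp [ihe (hF'.assign (holdsLit_neg.2 hv))]

/-- The combinatorial core: nine radially sorted points with exactly four hull vertices contain
an empty convex pentagon. -/
theorem RadiallySorted.not_noEmptyPentagon {f : ℕ → Pt} (hf : RadiallySorted f) {h : ℕ}
    (h1 : 1 < h) (h8 : h < 8) (h18 : Ccw f 1 h 8) (hl : ∀ i, 1 < i → i < h → ¬ Ccw f 1 i h)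
    (hr : ∀ i, h < i → i < 8 → ¬ Ccw f h i 8) : ¬ NoEmptyPentagon f := by
  intro hp
  have hlits : ∀ l ∈ hullLits h, HoldsLit f l := by
    intro l hmem
    simp only [hullLits, List.mem_append, List.mem_flatMap, List.mem_range, List.mem_cons,
      List.mem_ite_nil_right, List.not_mem_nil, or_false] at hmem
    rcases hmem with ⟨k, hk, j, hj, h0, rfl⟩ | rfl | ⟨i, hi, ⟨⟨hi1, hih⟩, rfl⟩ | ⟨hi1, rfl⟩⟩
    · exact holdsLit_pos.2 ((holds_triple (by omega) (by omega) (by omega)).2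
        (hf.sorted j k h0 hj hk))
    · exact holdsLit_pos.2 ((holds_triple (by omega) (by omega) (by omega)).2 h18)
    · rw [holdsLit_neg, holds_triple (by omega) (by omega) (by omega)]
      exact hl i hi1 hih
    · rw [holdsLit_neg, holds_triple (by omega) (by omega) (by omega)]
      exact hr i hi1 hi
  have hF : AllFalse f ((hullLits h).foldl assign 0) :=
    AllFalse.foldl_assign hlits fun l hl => by simp at hl
  have hfalse := (hullRefutation h).check_eq_false (hf.exists_holdsLit_clause hp) hF
  rw [hullRefutation_check h (by simp; omega)] at hfalse
  exact Bool.noConfusion hfalse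

/-! ### Convex hulls -/

theorem det_combo (p q x y : Pt) {a b : ℝ} (hab : a + b = 1) :
    det p q (a • x + b • y) = a * det p q x + b * det p q y := by
  obtain rfl : b = 1 - a := by linarith
  simp only [det, Prod.fst_add, Prod.snd_add, Prod.smul_fst, Prod.smul_snd, smul_eq_mul]
  ring

theorem det_nonneg_of_mem_convexHull {S : Set Pt} {p q x : Pt} (h : ∀ r ∈ S, 0 ≤ det p q r)
    (hx : x ∈ convexHull ℝ S) : 0 ≤ det p q x := by
  refine convexHull_min (t := {x | 0 ≤ det p q x}) h ?_ hx
  intro x hx y hy a b ha hb hab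
  simp only [Set.mem_ofPred_eq] at *
  rw [det_combo p q x y hab]
  positivity

/-- If the points of `S` other than `q` lie strictly on one side of the line `p q`, then `p` is
not in the convex hull of `S`. -/
theorem notMem_convexHull_of_edge {S : Set Pt} {p q : Pt} (hpq : p ≠ q) (s : ℝ)
    (h : ∀ r ∈ S, 0 < s * det p q r ∨ r = q) : p ∉ convexHull ℝ S := by
  let g : Pt → ℝ := fun x => (x.1 - p.1) * (q.1 - p.1) + (x.2 - p.2) * (q.2 - p.2)
  have hg : ∀ x y : Pt, ∀ a b : ℝ, a + b = 1 → g (a • x + b • y) = a * g x + b * g y := by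
    intro x y a b hab
    obtain rfl : b = 1 - a := by linarith
    simp only [g, Prod.fst_add, Prod.snd_add, Prod.smul_fst, Prod.smul_snd, smul_eq_mul]
    ring
  have hgq : 0 < g q := by
    have h0 : q.1 - p.1 ≠ 0 ∨ q.2 - p.2 ≠ 0 := by
      by_contra! h0
      exact hpq (Prod.ext (by linarith) (by linarith))
    rcases h0 with h0 | h0
    · have := mul_self_pos.2 h0
      have := mul_self_nonneg (q.2 - p.2)
      simp only [g]; linarith
    · have := mul_self_pos.2 h0
      have := mul_self_nonneg (q.1 - p.1)
      simp only [g]; linarith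
  have hq0 : det p q q = 0 := by unfold det; ring
  have hconv : Convex ℝ {x | 0 < s * det p q x ∨ (s * det p q x = 0 ∧ 0 < g x)} := by
    rw [convex_iff_forall_pos]
    intro x hx y hy a b ha hb hab
    simp only [Set.mem_ofPred_eq] at *
    rw [det_combo p q x y hab, hg x y a b hab,
      show s * (a * det p q x + b * det p q y) = a * (s * det p q x) + b * (s * det p q y) by ring]
    rcases hx with hx | ⟨hx, hx'⟩ <;> rcases hy with hy | ⟨hy, hy'⟩
    · left; positivity
    · left; rw [hy]; simp only [mul_zero, add_zero]; positivity
    · left; rw [hx]; simp only [mul_zero, zero_add]; positivity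
    · right; rw [hx, hy]; simp only [mul_zero, add_zero, true_and]; positivity
  intro hp
  have hmem := convexHull_min (fun r hr => ?_) hconv hp
  · have hp0 : det p q p = 0 := by unfold det; ring
    have hgp : g p = 0 := by simp [g]
    simp [hp0, hgp] at hmem
  · rcases h r hr with hr | rfl
    · exact Or.inl hr
    · exact Or.inr ⟨by rw [hq0, mul_zero], hgq⟩

theorem mem_convexHull_triangle {a b c x : Pt} (h1 : 0 < det a b x) (h2 : 0 < det b c x)
    (h3 : 0 < det c a x) : x ∈ convexHull ℝ ({a, b, c} : Set Pt) := by
  have hD : det a b x + det b c x + det c a x = det a b c := by unfold det; ring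
  have hpos : 0 < det a b c := by linarith
  refine mem_convexHull_of_exists_fintype
    (w := ![det b c x / det a b c, det c a x / det a b c, det a b x / det a b c])
    (z := ![a, b, c]) ?_ ?_ ?_ ?_
  · intro i
    fin_cases i <;> simp <;> positivity
  · simp [Fin.sum_univ_three]
    field_simp
    linarith
  · intro i
    fin_cases i <;> simp
  · ext <;> simp [Fin.sum_univ_three] <;> field_simp <;> unfold det <;> ring

theorem collinear_of_det_eq_zero {p q r : Pt} (h : det p q r = 0) :
    Collinear ℝ ({p, q, r} : Set Pt) := by
  by_cases hpq : p = q
  · subst hpq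
    simpa using collinear_pair ℝ p r
  rw [collinear_iff_of_mem (p₀ := p) (by simp)]
  refine ⟨q - p, ?_⟩
  have key : ∃ t : ℝ, r = t • (q - p) + p := by
    unfold det at h
    by_cases h1 : q.1 - p.1 = 0
    · have h2 : q.2 - p.2 ≠ 0 := fun h2 => hpq (Prod.ext (by linarith) (by linarith))
      refine ⟨(r.2 - p.2) / (q.2 - p.2), ?_⟩
      have h3 : r.1 - p.1 = 0 := by
        rw [h1, zero_mul, zero_sub, neg_eq_zero] at h
        exact (mul_eq_zero.1 h).resolve_left h2
      ext
      · simp [h1]; linarith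
      · simp; field_simp; ring
    · refine ⟨(r.1 - p.1) / (q.1 - p.1), ?_⟩
      ext
      · simp; field_simp; ring
      · simp; field_simp; linarith
  obtain ⟨t, ht⟩ := key
  rintro x (rfl | rfl | rfl)
  · exact ⟨0, by simp⟩
  · exact ⟨1, by simp⟩
  · exact ⟨t, by simpa using ht⟩

theorem GenPos.det_ne_zero {P : Finset Pt} (hP : GenPos P) {p q r : Pt} (hp : p ∈ P) (hq : q ∈ P)
    (hr : r ∈ P) (hpq : p ≠ q) (hpr : p ≠ r) (hqr : q ≠ r) : det p q r ≠ 0 :=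
  fun h => hP p hp q hq r hr hpq hpr hqr (collinear_of_det_eq_zero h)

theorem convexHull_hullVerts (P : Finset Pt) :
    convexHull ℝ (hullVerts P : Set Pt) = convexHull ℝ (P : Set Pt) := by
  refine (convexHull_mono (by exact_mod_cast Finset.filter_subset _ _)).antisymm ?_
  have hc : IsCompact (convexHull ℝ (P : Set Pt)) := P.finite_toSet.isCompact_convexHull ℝ
  rw [← closure_convexHull_extremePoints hc (convex_convexHull ℝ _)]
  refine closure_minimal (convexHull_mono fun x hx => ?_)
    ((hullVerts P).finite_toSet.isClosed_convexHull ℝ)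
  have hxP : x ∈ P := by exact_mod_cast extremePoints_convexHull_subset hx
  rw [(convex_convexHull ℝ _).mem_extremePoints_iff_mem_sdiff_convexHull_sdiff] at hx
  rw [Finset.mem_coe, hullVerts, Finset.mem_filter]
  refine ⟨hxP, fun h => hx.2 (convexHull_mono ?_ h)⟩
  rw [Finset.coe_erase]
  exact Set.sdiff_subset_sdiff_left (subset_convexHull ℝ _)

theorem exists_emptyConvexPentagon_of_ccw {P : Finset Pt} (hP : GenPos P) {v : Fin 5 → Pt}
    (hv : ∀ i, v i ∈ P) (hccw : ∀ i j k, i < j → j < k → 0 < det (v i) (v j) (v k))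
    (hempty : ∀ y ∈ P, (∀ i, y ≠ v i) → ¬ ∀ i, 0 < det (v i) (v (i + 1)) y) :
    ∃ S, EmptyConvexPentagon P S := by
  have hrot : ∀ p q r : Pt, det p q r = det q r p := by intros; unfold det; ring
  have hedge : ∀ i j, j ≠ i → j ≠ i + 1 → 0 < det (v i) (v (i + 1)) (v j) := by
    intro i j h1 h2
    have h : (i < i + 1 ∧ i + 1 < j) ∨ (j < i ∧ i < i + 1) ∨ (i + 1 < j ∧ j < i) := by
      revert i j; decide
    rcases h with h | h | h
    · exact hccw _ _ _ h.1 h.2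
    · rw [← hrot]; exact hccw _ _ _ h.1 h.2
    · rw [hrot]; exact hccw _ _ _ h.1 h.2
  have hinj : Function.Injective v := by
    intro i j hij
    by_contra hne
    obtain ⟨k, hk⟩ : ∃ k, (i < j ∧ j < k) ∨ (k < i ∧ i < j) ∨ (i < k ∧ k < j) ∨
        (j < i ∧ i < k) ∨ (k < j ∧ j < i) ∨ (j < k ∧ k < i) := by
      clear hij
      revert i j
      decide
    have : det (v i) (v i) (v k) = 0 ∧ det (v k) (v i) (v i) = 0 ∧ det (v i) (v k) (v i) = 0 := by
      refine ⟨?_, ?_, ?_⟩ <;> unfold det <;> ring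
    rcases hk with h | h | h | h | h | h <;> have := hccw _ _ _ h.1 h.2 <;> simp_all
  have hne : ∀ i : Fin 5, v i ≠ v (i + 1) := fun i h =>
    (by decide : ∀ i : Fin 5, i ≠ i + 1) i (hinj h)
  refine ⟨Finset.univ.image v, ?_, ?_, ?_, ?_⟩
  · intro x hx
    obtain ⟨i, -, rfl⟩ := Finset.mem_image.1 hx
    exact hv i
  · rw [Finset.card_image_of_injective _ hinj]; rfl
  · intro p hp
    obtain ⟨i, -, rfl⟩ := Finset.mem_image.1 hp
    refine notMem_convexHull_of_edge (hne i) 1 fun r hr => ?_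
    simp only [Finset.coe_erase, Set.mem_sdiff, Finset.mem_coe, Finset.mem_image, Finset.mem_univ,
      true_and, Set.mem_singleton_iff] at hr
    obtain ⟨⟨j, rfl⟩, hji⟩ := hr
    by_cases hj : j = i + 1
    · exact Or.inr (by rw [hj])
    · exact Or.inl (by rw [one_mul]; exact hedge i j (fun h => hji (by rw [h])) hj)
  · intro y hy hyS hyint
    have hyv : ∀ i, y ≠ v i := fun i h => hyS (h ▸ Finset.mem_image_of_mem v (Finset.mem_univ i))
    refine hempty y hy hyv fun i => lt_of_le_of_ne ?_
      (hP.det_ne_zero (hv i) (hv _) hy (hne i) (hyv i).symm (hyv _).symm).symm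
    refine det_nonneg_of_mem_convexHull (fun r hr => ?_) (interior_subset hyint)
    obtain ⟨j, -, rfl⟩ := Finset.mem_image.1 (Finset.mem_coe.1 hr)
    by_cases h1 : j = i
    · subst h1; exact le_of_eq (by unfold det; ring)
    by_cases h2 : j = i + 1
    · subst h2; exact le_of_eq (by unfold det; ring)
    exact (hedge i j h1 h2).le

/-! ### Radial sorting around a hull vertex -/

theorem exists_radial_key {P : Finset Pt} {p : Pt} (hp : p ∈ hullVerts P) :
    ∃ key : Pt → ℝ, ∀ x ∈ P, ∀ y ∈ P, x ≠ p → y ≠ p → (0 < det p x y ↔ key x < key y) := by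
  obtain ⟨-, hp⟩ := Finset.mem_filter.1 hp
  obtain ⟨φ, u, hu, hφ⟩ := geometric_hahn_banach_point_closed (convex_convexHull ℝ _)
    ((P.erase p).finite_toSet.isClosed_convexHull ℝ) hp
  obtain ⟨m, n, hmn⟩ : ∃ m n : ℝ, ∀ x : Pt, φ x = m * x.1 + n * x.2 := by
    refine ⟨φ (1, 0), φ (0, 1), fun x => ?_⟩
    have : x = x.1 • ((1, 0) : Pt) + x.2 • ((0, 1) : Pt) := by ext <;> simp
    conv_lhs => rw [this]
    rw [map_add, map_smul, map_smul, smul_eq_mul, smul_eq_mul]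
    ring
  have hpos : ∀ x ∈ P, x ≠ p → 0 < m * (x.1 - p.1) + n * (x.2 - p.2) := by
    intro x hx hxp
    have h := hφ x (subset_convexHull ℝ _ (Finset.mem_coe.2 (Finset.mem_erase.2 ⟨hxp, hx⟩)))
    rw [hmn] at h hu
    linarith
  refine ⟨fun x => (m * (x.2 - p.2) - n * (x.1 - p.1)) / (m * (x.1 - p.1) + n * (x.2 - p.2)),
    fun x hx y hy hxp hyp => ?_⟩
  have h1 := hpos x hx hxp
  have h2 := hpos y hy hyp
  have h0 : 0 < m ^ 2 + n ^ 2 := by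
    by_contra h
    have hm : m = 0 := by nlinarith [sq_nonneg m, sq_nonneg n]
    have hn : n = 0 := by nlinarith [sq_nonneg m, sq_nonneg n]
    rw [hm, hn] at h1
    linarith
  have : (m ^ 2 + n ^ 2) * det p x y =
      (m * (y.2 - p.2) - n * (y.1 - p.1)) * (m * (x.1 - p.1) + n * (x.2 - p.2)) -
      (m * (x.2 - p.2) - n * (x.1 - p.1)) * (m * (y.1 - p.1) + n * (y.2 - p.2)) := by
    unfold det; ring
  rw [div_lt_div_iff₀ h1 h2, ← mul_pos_iff_of_pos_left (b := det p x y) h0, this, sub_pos]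

theorem exists_radiallySorted {P : Finset Pt} (hcard : P.card = 9) (hP : GenPos P) {p : Pt}
    (hp : p ∈ hullVerts P) :
    ∃ f : ℕ → Pt, f 0 = p ∧ RadiallySorted f ∧ (Finset.range 9).image f = P ∧
      Set.InjOn f (Finset.range 9 : Set ℕ) := by
  obtain ⟨key, hkey⟩ := exists_radial_key hp
  have hpP : p ∈ P := (Finset.mem_filter.1 hp).1
  have hinj : Set.InjOn key (P.erase p : Finset Pt) := by
    intro x hx y hy hxy
    obtain ⟨hxp, hx⟩ := Finset.mem_erase.1 (Finset.mem_coe.1 hx)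
    obtain ⟨hyp, hy⟩ := Finset.mem_erase.1 (Finset.mem_coe.1 hy)
    by_contra hne
    have h1 := (hkey x hx y hy hxp hyp).not.2 (by rw [hxy]; exact lt_irrefl _)
    have h2 := (hkey y hy x hx hyp hxp).not.2 (by rw [hxy]; exact lt_irrefl _)
    have h3 : det p y x = - det p x y := by unfold det; ring
    exact hP.det_ne_zero hpP hx hy hxp.symm hyp.symm hne (by linarith)
  have hT : ((P.erase p).image key).card = 8 := by
    rw [Finset.card_image_of_injOn hinj, Finset.card_erase_of_mem hpP, hcard]
  let e := ((P.erase p).image key).orderEmbOfFin hT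
  have he : ∀ i, ∃ x, (x ∈ P ∧ x ≠ p) ∧ key x = e i := by
    intro i
    obtain ⟨x, hx, hxi⟩ := Finset.mem_image.1 (Finset.orderEmbOfFin_mem _ hT i)
    exact ⟨x, (Finset.mem_erase.1 hx).symm, hxi⟩
  choose g hg hge using he
  let f : ℕ → Pt := fun i => if h : 0 < i ∧ i < 9 then g ⟨i - 1, by omega⟩ else p
  have hf0 : f 0 = p := rfl
  have hf : ∀ i (h0 : 0 < i) (h9 : i < 9), f i = g ⟨i - 1, by omega⟩ :=
    fun i h0 h9 => dif_pos ⟨h0, h9⟩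
  have hmem : ∀ i, f i ∈ P := by
    intro i
    by_cases h : 0 < i ∧ i < 9
    · rw [hf i h.1 h.2]; exact (hg _).1
    · simp only [f, dif_neg h]; exact hpP
  have hsort : ∀ j k, 0 < j → j < k → k < 9 → Ccw f 0 j k := by
    intro j k h0 hjk h9
    unfold Ccw
    rw [hf0, hf j h0 (by omega), hf k (by omega) h9,
      hkey _ (hg _).1 _ (hg _).1 (hg _).2 (hg _).2, hge, hge]
    exact e.strictMono (by rw [Fin.mk_lt_mk]; omega)
  have hfinj : Set.InjOn f (Finset.range 9 : Set ℕ) := by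
    have key_lt : ∀ i j, i < j → j < 9 → f i ≠ f j := by
      intro i j hij h9 h
      rcases Nat.eq_zero_or_pos i with rfl | h0
      · rw [hf0, hf j hij h9] at h
        exact (hg _).2 h.symm
      · have := hsort i j h0 hij h9
        rw [Ccw, h] at this
        exact absurd this (not_lt.2 (le_of_eq (by unfold det; ring)))
    intro i hi j hj h
    simp only [Finset.coe_range, Set.mem_Iio] at hi hj
    rcases lt_trichotomy i j with hij | hij | hij
    · exact absurd h (key_lt i j hij hj)
    · exact hij
    · exact absurd h.symm (key_lt j i hij hi)
  refine ⟨f, hf0, ⟨hsort, fun i j k hi hj hk hij hik hjk => ?_⟩, ?_, hfinj⟩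
  · have hne : ∀ {i j}, i < 9 → j < 9 → i ≠ j → f i ≠ f j := fun hi hj h hij =>
      h (hfinj (by simpa using hi) (by simpa using hj) hij)
    exact hP.det_ne_zero (hmem i) (hmem j) (hmem k) (hne hi hj hij) (hne hi hk hik) (hne hj hk hjk)
  · refine Finset.eq_of_subset_of_card_le (fun x hx => ?_) ?_
    · obtain ⟨i, -, rfl⟩ := Finset.mem_image.1 hx
      exact hmem i
    · rw [Finset.card_image_of_injOn hfinj, hcard, Finset.card_range]

theorem mem_hullVerts_of_edge {P : Finset Pt} {p q : Pt} (hp : p ∈ P) (hpq : p ≠ q) (s : ℝ)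
    (h : ∀ r ∈ P, r ≠ p → r ≠ q → 0 < s * det p q r) : p ∈ hullVerts P := by
  refine Finset.mem_filter.2 ⟨hp, notMem_convexHull_of_edge hpq s fun r hr => ?_⟩
  obtain ⟨hrp, hr⟩ := Finset.mem_erase.1 (Finset.mem_coe.1 hr)
  by_cases hrq : r = q
  · exact Or.inr hrq
  · exact Or.inl (h r hr hrp hrq)

theorem notMem_hullVerts_of_triangle {P : Finset Pt} {a b c x : Pt} (ha : a ∈ P) (hb : b ∈ P)
    (hc : c ∈ P) (h1 : 0 < det a b x) (h2 : 0 < det b c x) (h3 : 0 < det c a x) :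
    x ∉ hullVerts P := by
  intro hx
  refine (Finset.mem_filter.1 hx).2 (convexHull_mono ?_ (mem_convexHull_triangle h1 h2 h3))
  have h0 : ∀ p q : Pt, det p q p = 0 ∧ det p q q = 0 := by
    intros; constructor <;> unfold det <;> ring
  rintro y (rfl | rfl | rfl) <;> refine Finset.mem_coe.2 (Finset.mem_erase.2 ⟨?_, ‹_›⟩) <;>
    rintro rfl
  · exact h1.ne' (h0 _ _).1
  · exact h1.ne' (h0 _ _).2
  · exact h2.ne' (h0 _ _).2

theorem det_nonneg_of_hullVerts {P : Finset Pt} {p q x : Pt} (h : ∀ r ∈ hullVerts P, 0 ≤ det p q r)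
    (hx : x ∈ P) : 0 ≤ det p q x := by
  refine det_nonneg_of_mem_convexHull (S := hullVerts P) (fun r hr => h r (Finset.mem_coe.1 hr)) ?_
  rw [convexHull_hullVerts]
  exact subset_convexHull ℝ _ (Finset.mem_coe.2 hx)

theorem exists_emptyConvexPentagon_of_not_noEmptyPentagon {P : Finset Pt} (hP : GenPos P)
    {f : ℕ → Pt} (hmem : ∀ i < 9, f i ∈ P) (hex : ∀ x ∈ P, ∃ i < 9, f i = x)
    (h : ¬ NoEmptyPentagon f) : ∃ S, EmptyConvexPentagon P S := by
  contrapose! h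
  intro a b c d e ha hb hc hd he h1 h2 h3 h4 h5 h6 h7 h8 h9 h10
  by_contra! hy
  obtain ⟨S, hS⟩ := exists_emptyConvexPentagon_of_ccw hP (v := ![f a, f b, f c, f d, f e])
    (by simp [Fin.forall_fin_succ, *])
    (by
      intro i j k hij hjk
      fin_cases i <;> fin_cases j <;> first | exact absurd hij (by decide) | skip
      all_goals fin_cases k <;> first | exact absurd hjk (by decide) | assumption)
    (by
      intro y hyP hne hedge
      obtain ⟨j, hj, rfl⟩ := hex y hyP
      exact hy j hj (fun h => hne 0 (congrArg f h)) (fun h => hne 1 (congrArg f h))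
        (fun h => hne 2 (congrArg f h)) (fun h => hne 3 (congrArg f h))
        (fun h => hne 4 (congrArg f h)) (hedge 0) (hedge 1) (hedge 2) (hedge 3) (hedge 4))
  exact h S hS

/-- Every 9-point set in general position of convex layer type (4,4,1) or (4,3,2)
contains an empty convex pentagon. -/
theorem stmt18 (P : Finset Pt) (hcard : P.card = 9) (hgp : GenPos P)
    (h1 : (hullVerts P).card = 4)
    (h2 : (hullVerts (P \ hullVerts P)).card = 4 ∨
          (hullVerts (P \ hullVerts P)).card = 3) :
    ∃ S, EmptyConvexPentagon P S := by
  obtain ⟨p, hp⟩ : (hullVerts P).Nonempty := Finset.card_pos.1 (by omega)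
  obtain ⟨f, rfl, hf, hfP, hinj⟩ := exists_radiallySorted hcard hgp hp
  have hmem : ∀ i < 9, f i ∈ P := fun i hi =>
    hfP ▸ Finset.mem_image_of_mem f (Finset.mem_range.2 hi)
  have hex : ∀ x ∈ P, ∃ i < 9, f i = x := by
    intro x hx
    rw [← hfP] at hx
    obtain ⟨i, hi, h⟩ := Finset.mem_image.1 hx
    exact ⟨i, Finset.mem_range.1 hi, h⟩
  have hne : ∀ {i j}, i < 9 → j < 9 → i ≠ j → f i ≠ f j := fun hi hj h hij =>
    h (hinj (by simpa using hi) (by simpa using hj) hij)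
  have hrot : ∀ p q r : Pt, det p q r = det q r p := by intros; unfold det; ring
  have hswap : ∀ p q r : Pt, det p q r = - det q p r := by intros; unfold det; ring
  have hself : ∀ p q : Pt, det p q p = 0 ∧ det p q q = 0 := by
    intros; constructor <;> unfold det <;> ring
  have hf1 : f 1 ∈ hullVerts P := by
    refine mem_hullVerts_of_edge (hmem 1 (by omega)) (hne (by omega) (by omega) one_ne_zero) (-1) ?_
    intro r hr hr1 hr0
    obtain ⟨j, hj, rfl⟩ := hex r hr
    have h0 : j ≠ 0 := fun h => hr0 (by rw [h])
    have h1 : j ≠ 1 := fun h => hr1 (by rw [h])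
    have := hf.sorted 1 j (by omega) (by omega) hj
    rw [Ccw, hswap] at this
    linarith
  have hf8 : f 8 ∈ hullVerts P := by
    refine mem_hullVerts_of_edge (hmem 8 (by omega)) (hne (by omega) (by omega)
      (by omega : 8 ≠ 0)) 1 ?_
    intro r hr hr8 hr0
    obtain ⟨j, hj, rfl⟩ := hex r hr
    have h0 : j ≠ 0 := fun h => hr0 (by rw [h])
    have h8 : j ≠ 8 := fun h => hr8 (by rw [h])
    rw [one_mul, hrot]
    exact hf.sorted j 8 (by omega) (by omega) (by omega)
  obtain ⟨x, hx, hx018⟩ : ∃ x ∈ hullVerts P, x ∉ ({f 0, f 1, f 8} : Finset Pt) :=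
    Finset.exists_mem_notMem_of_card_lt_card (lt_of_le_of_lt Finset.card_le_three (by omega))
  simp only [Finset.mem_insert, Finset.mem_singleton, not_or] at hx018
  obtain ⟨h, hh, rfl⟩ := hex x (Finset.mem_filter.1 hx).1
  have hh0 : h ≠ 0 := fun h => hx018.1 (by rw [h])
  have hh1 : h ≠ 1 := fun h => hx018.2.1 (by rw [h])
  have hh8 : h ≠ 8 := fun h => hx018.2.2 (by rw [h])
  have hhull : hullVerts P = {f 0, f 1, f h, f 8} := by
    symm
    refine Finset.eq_of_subset_of_card_le ?_ ?_
    · simp [Finset.insert_subset_iff, hp, hf1, hx, hf8]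
    · have h01 := hne (i := 0) (j := 1) (by omega) (by omega) (by omega)
      have h08 := hne (i := 0) (j := 8) (by omega) (by omega) (by omega)
      have h18 := hne (i := 1) (j := 8) (by omega) (by omega) (by omega)
      rw [h1, Finset.card_insert_of_notMem, Finset.card_insert_of_notMem,
        Finset.card_pair hx018.2.2]
      · simp [h18, Ne.symm hx018.2.1]
      · simp [h01, h08, Ne.symm hx018.1]
  have h18 : Ccw f 1 h 8 := by
    by_contra hc
    have hlt : det (f 1) (f h) (f 8) < 0 := lt_of_le_of_ne (not_lt.1 hc)
      (hf.det_ne _ _ _ (by omega) (by omega) (by omega) (by omega) (by omega) (by omega))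
    refine notMem_hullVerts_of_triangle (hmem 0 (by omega)) (hmem 1 (by omega)) (hmem 8 (by omega))
      (hf.sorted 1 h (by omega) (by omega) (by omega)) ?_ ?_ hx
    · rw [hswap, hrot]; linarith
    · rw [hrot]; exact hf.sorted h 8 (by omega) (by omega) (by omega)
  have hs1 := hf.sorted 1 h (by omega) (by omega) (by omega)
  have hs8 := hf.sorted h 8 (by omega) (by omega) (by omega)
  rw [Ccw] at hs1 hs8
  refine exists_emptyConvexPentagon_of_not_noEmptyPentagon hgp hmem hex
    (hf.not_noEmptyPentagon (by omega) (by omega) h18 (fun i hi hih => ?_) fun i hhi hi => ?_)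
  · have := det_nonneg_of_hullVerts (p := f 1) (q := f h) (by
      rw [hhull]
      simpa [hself, ← hrot (f 0)] using ⟨hs1.le, h18.le⟩) (hmem i (by omega))
    rw [Ccw, not_lt, ← hrot, hswap]
    linarith
  · have := det_nonneg_of_hullVerts (p := f h) (q := f 8) (by
      rw [hhull]
      simpa [hself, ← hrot (f 0), ← hrot (f 1)] using ⟨hs8.le, h18.le⟩) (hmem i (by omega))
    rw [Ccw, not_lt, ← hrot, hswap]
    linarith
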